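/- Let D ⊆ ℝ² be the open unit disk and let β ∈ (1/2, 1). There is no C^∞ function v : D → ℝ, positive everywhere, satisfying both of the following: (i) for every smooth function φ : ℝ² → ℝ that is not identically zero and whose (compact) support is contained in D, ∫_D (‖∇(φ·v)‖² + β·(v·Δv − ‖∇v‖²)·φ²) dx > 0; (ii) every C¹ curve γ : [0,1) → D that eventually leaves every compact subset of D satisfies ∫₀¹ ‖γ′(t)‖ / v(γ(t)) dt = +∞. -/

import Mathlib

/-- The Euclidean Laplacian: sum of the second partial derivatives along the
coordinate directions. -/
noncomputable def eLaplacian {n : ℕ} (f : EuclideanSpace ℝ (Fin n) → ℝ)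
    (x : EuclideanSpace ℝ (Fin n)) : ℝ :=
  ∑ i, fderiv ℝ (fun y => fderiv ℝ f y (EuclideanSpace.single i 1)) x
    (EuclideanSpace.single i 1)

open Metric Set

section ConformalMetric

variable {E : Type*} [NormedAddCommGroup E]

/-- The closed ball of radius `s` about `x` lies well inside the unit ball, and the density `w`
varies by a factor at most two between `x` and any point of it. -/
structure IsHarnackRadius (w : E → ℝ) (x : E) (s : ℝ) : Prop where
  pos : 0 < s
  le : s ≤ (1 - ‖x‖) / 2
  le_center : ∀ z ∈ closedBall x s, w z ≤ 2 * w x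
  center_le : ∀ z ∈ closedBall x s, w x ≤ 2 * w z

theorem IsHarnackRadius.subset {w : E → ℝ} {x : E} {s : ℝ} (h : IsHarnackRadius w x s) :
    closedBall x s ⊆ ball 0 1 := by
  intro z hz
  have h1 := h.pos
  have h2 := h.le
  have h3 : ‖z‖ ≤ ‖x‖ + ‖z - x‖ := by simpa using norm_add_le x (z - x)
  rw [mem_closedBall, dist_eq_norm] at hz
  rw [mem_ball_zero_iff]
  linarith

theorem IsHarnackRadius.norm_le {w : E → ℝ} {x z : E} {s : ℝ} (h : IsHarnackRadius w x s)
    (hz : z ∈ closedBall x s) : ‖x‖ - (1 - ‖x‖) / 2 ≤ ‖z‖ := by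
  have h2 := h.le
  have h3 : ‖x‖ ≤ ‖z‖ + ‖z - x‖ := by
    simpa [norm_sub_rev] using norm_add_le z (x - z)
  rw [mem_closedBall, dist_eq_norm] at hz
  linarith

theorem exists_isHarnackRadius_of_norm_le [ProperSpace E] {w : E → ℝ}
    (hw : ContinuousOn w (ball 0 1)) (hpos : ∀ x ∈ ball (0 : E) 1, 0 < w x) {r : ℝ} (hr : r < 1) :
    ∃ σ > 0, ∀ x : E, ‖x‖ ≤ r → IsHarnackRadius w x σ := by
  have hsub : closedBall (0 : E) ((1 + r) / 2) ⊆ ball 0 1 := closedBall_subset_ball (by linarith)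
  have hK : IsCompact (closedBall (0 : E) ((1 + r) / 2)) := isCompact_closedBall _ _
  obtain ⟨m, hm, hmw⟩ : ∃ m > 0, ∀ x ∈ closedBall (0 : E) ((1 + r) / 2), m ≤ w x := by
    rcases (closedBall (0 : E) ((1 + r) / 2)).eq_empty_or_nonempty with he | hne
    · exact ⟨1, one_pos, by simp [he]⟩
    · obtain ⟨a, ha, hmin⟩ := hK.exists_isMinOn hne (hw.mono hsub)
      exact ⟨w a, hpos a (hsub ha), fun x hx => hmin hx⟩
  have huc := hK.uniformContinuousOn_of_continuous (hw.mono hsub)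
  obtain ⟨δ, hδ, hδw⟩ := Metric.uniformContinuousOn_iff.1 huc (m / 2) (by linarith)
  refine ⟨min (δ / 2) ((1 - r) / 2), lt_min (by linarith) (by linarith), fun x hx => ?_⟩
  have key : ∀ z ∈ closedBall x (min (δ / 2) ((1 - r) / 2)),
      |w z - w x| < m / 2 ∧ m ≤ w z ∧ m ≤ w x := by
    intro z hz
    rw [mem_closedBall, le_min_iff] at hz
    have hz' : z ∈ closedBall (0 : E) ((1 + r) / 2) := by
      have h3 : ‖z‖ ≤ ‖x‖ + ‖z - x‖ := by simpa using norm_add_le x (z - x)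
      rw [mem_closedBall_zero_iff]
      rw [dist_eq_norm] at hz
      linarith [hz.2]
    have hx' : x ∈ closedBall (0 : E) ((1 + r) / 2) := by
      rw [mem_closedBall_zero_iff]; linarith
    exact ⟨hδw z hz' x hx' (by linarith [hz.1]), hmw z hz', hmw x hx'⟩
  refine ⟨lt_min (by linarith) (by linarith), (min_le_right _ _).trans (by linarith), ?_, ?_⟩ <;>
  · intro z hz
    obtain ⟨h1, h2, h3⟩ := key z hz
    rw [abs_lt] at h1
    linarith [h1.1, h1.2]

theorem exists_harnackRadius [ProperSpace E] {w : E → ℝ}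
    (hw : ContinuousOn w (ball 0 1)) (hpos : ∀ x ∈ ball (0 : E) 1, 0 < w x) :
    ∃ s : E → ℝ, (∀ x ∈ ball (0 : E) 1, IsHarnackRadius w x (s x)) ∧
      ∀ r < 1, ∃ σ > 0, ∀ x : E, ‖x‖ ≤ r → σ ≤ s x := by
  have h : ∀ x ∈ ball (0 : E) 1, ∃ t, IsHarnackRadius w x t ∧
      ∀ σ, IsHarnackRadius w x σ → σ / 2 ≤ t := by
    intro x hx
    obtain ⟨σ, hσ, hσx⟩ := exists_isHarnackRadius_of_norm_le hw hpos (mem_ball_zero_iff.1 hx)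
    have hx' := hσx x le_rfl
    have hbdd : BddAbove {t | IsHarnackRadius w x t} := ⟨_, fun t ht => ht.le⟩
    have hlt : sSup {t | IsHarnackRadius w x t} / 2 < sSup {t | IsHarnackRadius w x t} := by
      have := le_csSup hbdd (show σ ∈ {t | IsHarnackRadius w x t} from hx')
      linarith
    obtain ⟨t, ht, hlt⟩ := exists_lt_of_lt_csSup ⟨σ, hx'⟩ hlt
    refine ⟨t, ht, fun τ hτ => ?_⟩
    have := le_csSup hbdd (show τ ∈ {t | IsHarnackRadius w x t} from hτ)
    linarith
  choose! s hs hs' using h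
  refine ⟨s, hs, fun r hr => ?_⟩
  obtain ⟨σ, hσ, hσx⟩ := exists_isHarnackRadius_of_norm_le hw hpos hr
  exact ⟨σ / 2, by linarith, fun x hx =>
    hs' x (mem_ball_zero_iff.2 (hx.trans_lt hr)) σ (hσx x hx)⟩

variable [NormedSpace ℝ E]

/-- `f` vanishes near the unit sphere and is `1`-Lipschitz, in the infinitesimal sense, for the
conformal metric `w ^ 2 |dx|^2` on the unit ball. -/
structure IsConformalCutoff (w f : E → ℝ) : Prop where
  eq_zero : ∃ r < 1, ∀ z : E, r ≤ ‖z‖ → f z = 0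
  sub_le : ∀ S : Set E, Convex ℝ S → S ⊆ ball 0 1 → ∀ M, (∀ z ∈ S, w z ≤ M) →
    ∀ y ∈ S, ∀ z ∈ S, f y - f z ≤ M * dist y z

namespace IsConformalCutoff

variable {w f g : E → ℝ}

theorem zero (hpos : ∀ x ∈ ball (0 : E) 1, 0 < w x) : IsConformalCutoff w 0 where
  eq_zero := ⟨0, one_pos, fun _ _ => rfl⟩
  sub_le S _ hS M hM y hy z _ := by
    have := (hpos y (hS hy)).trans_le (hM y hy)
    simpa using mul_nonneg this.le dist_nonneg

theorem sup (hf : IsConformalCutoff w f) (hg : IsConformalCutoff w g) :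
    IsConformalCutoff w (f ⊔ g) where
  eq_zero := by
    obtain ⟨r, hr, h⟩ := hf.eq_zero
    obtain ⟨r', hr', h'⟩ := hg.eq_zero
    exact ⟨max r r', max_lt hr hr', fun z hz => by
      simp [h z ((le_max_left _ _).trans hz), h' z ((le_max_right _ _).trans hz)]⟩
  sub_le S hS hS1 M hM y hy z hz := by
    have h1 := hf.sub_le S hS hS1 M hM y hy z hz
    have h2 := hg.sub_le S hS hS1 M hM y hy z hz
    have h3 := le_max_left (f z) (g z)
    have h4 := le_max_right (f z) (g z)
    simp only [Pi.sup_apply, tsub_le_iff_right]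
    exact max_le (by linarith) (by linarith)

theorem continuous [ProperSpace E] (hf : IsConformalCutoff w f) (hw : ContinuousOn w (ball 0 1)) :
    Continuous f := by
  obtain ⟨r, hr, h⟩ := hf.eq_zero
  rw [continuous_iff_continuousAt]
  intro x
  rcases lt_or_ge r ‖x‖ with hx | hx
  · have : f =ᶠ[nhds x] fun _ => 0 := by
      filter_upwards [(isOpen_lt continuous_const continuous_norm).mem_nhds hx] with z hz
      exact h z hz.le
    exact continuousAt_const.congr this.symm
  · have hsub : closedBall (0 : E) ((1 + r) / 2) ⊆ ball 0 1 := closedBall_subset_ball (by linarith)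
    obtain ⟨M, hM⟩ := (isCompact_closedBall (0 : E) ((1 + r) / 2)).bddAbove_image (hw.mono hsub)
    have hL := hf.sub_le _ (convex_closedBall _ _) hsub M
      (fun z hz => hM (mem_image_of_mem w hz))
    have hL' : LipschitzOnWith M.toNNReal f (closedBall (0 : E) ((1 + r) / 2)) := by
      refine LipschitzOnWith.of_dist_le_mul fun y hy z hz => ?_
      have hM' : M * dist y z ≤ M.toNNReal * dist y z :=
        mul_le_mul_of_nonneg_right (Real.le_coe_toNNReal M) dist_nonneg
      have h1 := hL y hy z hz
      have h2 := hL z hz y hy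
      rw [dist_comm z y] at h2
      rw [Real.dist_eq, abs_le]
      constructor <;> linarith
    refine hL'.continuousOn.continuousAt (mem_nhds_iff.2 ⟨ball 0 ((1 + r) / 2),
      ball_subset_closedBall, isOpen_ball, ?_⟩)
    rw [mem_ball_zero_iff]; linarith

/-- A cutoff can be raised to a cone over a ball on whose boundary it is at least `m`. -/
theorem exists_cone_le (hf : IsConformalCutoff w f)
    {x : E} {s c m : ℝ} (hs : 0 ≤ s) (hxs : ‖x‖ + s < 1)
    (hcw : ∀ z ∈ closedBall x s, c ≤ w z) (hc : 0 ≤ c) (hm : ∀ z ∈ sphere x s, m ≤ f z) :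
    ∃ g, IsConformalCutoff w g ∧ m + c * s ≤ g x := by
  classical
  set h : E → ℝ := fun z => m + c * (s - dist z x) with hdef
  set g : E → ℝ := fun z => if dist z x ≤ s then max (f z) (h z) else f z with hgdef
  have hin : ∀ z, dist z x ≤ s → g z = max (f z) (h z) := fun z hz => if_pos hz
  have hout : ∀ z, s ≤ dist z x → g z = f z := by
    intro z hz
    rcases hz.eq_or_lt with he | hl
    · rw [hin z he.ge, max_eq_left]
      simpa [hdef, ← he] using hm z he.symm
    · exact if_neg (not_le.2 hl)
  refine ⟨g, ⟨?_, ?_⟩, ?_⟩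
  · obtain ⟨r, hr, h0⟩ := hf.eq_zero
    refine ⟨max r (‖x‖ + s), max_lt hr hxs, fun z hz => ?_⟩
    rw [hout, h0 z ((le_max_left _ _).trans hz)]
    have h3 : ‖z‖ ≤ ‖x‖ + ‖z - x‖ := by simpa using norm_add_le x (z - x)
    have := (le_max_right _ _).trans hz
    rw [dist_eq_norm]; linarith
  · intro S hS hS1 M hM
    have hff := hf.sub_le S hS hS1 M hM
    have inside : ∀ y ∈ S, ∀ z ∈ S, dist y x ≤ s → dist z x ≤ s → g y - g z ≤ M * dist y z := by
      intro y hy z hz hyx hzx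
      rw [hin y hyx, hin z hzx]
      have h1 := hff y hy z hz
      have hcM : c ≤ M := (hcw y hyx).trans (hM y hy)
      have h2 : h y - h z ≤ M * dist y z := by
        have e1 : h y - h z = c * (dist z x - dist y x) := by simp only [hdef]; ring
        have e2 : dist z x - dist y x ≤ dist y z := by
          have := dist_triangle z y x
          rw [dist_comm z y] at this; linarith
        rw [e1]
        exact (mul_le_mul_of_nonneg_left e2 hc).trans
          (mul_le_mul_of_nonneg_right hcM dist_nonneg)
      have h3 := le_max_left (f z) (h z)
      have h4 := le_max_right (f z) (h z)
      rw [tsub_le_iff_right]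
      exact max_le (by linarith) (by linarith)
    have cross : ∀ y ∈ S, ∀ z ∈ S, dist y x ≤ s → s ≤ dist z x →
        g y - g z ≤ M * dist y z ∧ g z - g y ≤ M * dist y z := by
      intro y hy z hz hyx hzx
      obtain ⟨p, hp, hps⟩ := (convex_segment y z).isPreconnected.intermediate_value
        (left_mem_segment ℝ y z) (right_mem_segment ℝ y z)
        (f := fun q => dist q x) (by fun_prop) ⟨hyx, hzx⟩
      have hpS := hS.segment_subset hy hz hp
      have hd := dist_add_dist_of_mem_segment hp
      simp only at hps
      have a1 := inside y hy p hpS hyx hps.le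
      have a2 := inside p hpS y hy hps.le hyx
      have b1 := hff p hpS z hz
      have b2 := hff z hz p hpS
      rw [← hout p hps.ge, ← hout z hzx] at b1 b2
      rw [dist_comm p y] at a2
      rw [dist_comm z p] at b2
      rw [← hd]
      constructor <;> linarith
    intro y hy z hz
    rcases le_total (dist y x) s with hyx | hyx <;> rcases le_total (dist z x) s with hzx | hzx
    · exact inside y hy z hz hyx hzx
    · exact (cross y hy z hz hyx hzx).1
    · rw [dist_comm]; exact (cross z hz y hy hzx hyx).2
    · rw [hout y hyx, hout z hzx]; exact hff y hy z hz
  · rw [hin x (by simpa using hs)]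
    refine le_trans ?_ (le_max_right _ _)
    simp [hdef]

end IsConformalCutoff

/-- If all cutoffs are bounded by `L` at `x`, then the bound improves by a definite amount at some
point of any small sphere about `x`. -/
theorem exists_mem_sphere_cutoff_le [ProperSpace E] [Nontrivial E] {w : E → ℝ}
    (hw : ContinuousOn w (ball 0 1)) (hpos : ∀ x ∈ ball (0 : E) 1, 0 < w x) {x : E} {s L : ℝ}
    (hs : IsHarnackRadius w x s) (hL : ∀ f, IsConformalCutoff w f → f x ≤ L) :
    ∃ y ∈ sphere x s, ∀ f, IsConformalCutoff w f → f y ≤ L - w x * s / 2 := by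
  by_contra! hcon
  let ι := {f : E → ℝ // IsConformalCutoff w f}
  have : Nonempty ι := ⟨⟨0, IsConformalCutoff.zero hpos⟩⟩
  obtain ⟨f, hf⟩ := (isCompact_sphere x s).elim_directed_cover
    (fun f : ι => {z | L - w x * s / 2 < f.1 z})
    (fun f => isOpen_lt continuous_const (f.2.continuous hw))
    (fun y hy => by
      obtain ⟨f, hf, hlt⟩ := hcon y hy
      exact mem_iUnion.2 ⟨⟨f, hf⟩, hlt⟩)
    (fun f g => ⟨⟨_, f.2.sup g.2⟩, fun z hz => (mem_ofPred.1 hz).trans_le (le_max_left _ _),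
      fun z hz => (mem_ofPred.1 hz).trans_le (le_max_right _ _)⟩)
  obtain ⟨a, ha, hmin⟩ := (isCompact_sphere x s).exists_isMinOn
    (NormedSpace.sphere_nonempty.2 hs.pos.le) (f.2.continuous hw).continuousOn
  have hx : x ∈ ball (0 : E) 1 := hs.subset (mem_closedBall_self hs.pos.le)
  have hlt : ‖x‖ < 1 := mem_ball_zero_iff.1 hx
  obtain ⟨g, hg, hgx⟩ := f.2.exists_cone_le (c := w x / 2) (m := f.1 a) hs.pos.le
    (by linarith [hs.le]) (fun z hz => by linarith [hs.center_le z hz])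
    (by linarith [hpos x hx]) (fun z hz => hmin hz)
  have h1 : L - w x * s / 2 < f.1 a := hf ha
  have := hL g hg
  linarith

/-- If all cutoffs are bounded at one point, some sequence of finite length leaves every compact
subset of the ball. -/
theorem exists_seq_of_cutoff_le [ProperSpace E] [Nontrivial E] {w : E → ℝ}
    (hw : ContinuousOn w (ball 0 1)) (hpos : ∀ x ∈ ball (0 : E) 1, 0 < w x) {x₀ : E} {L : ℝ}
    (hx₀ : x₀ ∈ ball (0 : E) 1) (hL : ∀ f, IsConformalCutoff w f → f x₀ ≤ L) :
    ∃ (x : ℕ → E) (s : ℕ → ℝ), (∀ k, IsHarnackRadius w (x k) (s k)) ∧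
      (∀ k, dist (x (k + 1)) (x k) = s k) ∧ (Summable fun k => w (x k) * s k) ∧
      ∀ r < 1, ∀ᶠ k in Filter.atTop, r < ‖x k‖ := by
  obtain ⟨s, hs, hs'⟩ := exists_harnackRadius hw hpos
  let A := {p : E × ℝ // p.1 ∈ ball (0 : E) 1 ∧ ∀ f, IsConformalCutoff w f → f p.1 ≤ p.2}
  have step : ∀ p : A, ∃ q : A, dist q.1.1 p.1.1 = s p.1.1 ∧
      q.1.2 = p.1.2 - w p.1.1 * s p.1.1 / 2 := by
    rintro ⟨⟨x, l⟩, hx, hl⟩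
    obtain ⟨y, hy, hyl⟩ := exists_mem_sphere_cutoff_le hw hpos (hs x hx) hl
    exact ⟨⟨(y, _), (hs x hx).subset (sphere_subset_closedBall hy), hyl⟩, hy, rfl⟩
  choose next hdist hval using step
  let u : ℕ → A := fun k => next^[k] ⟨(x₀, L), hx₀, hL⟩
  have hu : ∀ k, u (k + 1) = next (u k) := fun k => Function.iterate_succ_apply' _ _ _
  have hball : ∀ k, (u k).1.1 ∈ ball (0 : E) 1 := fun k => (u k).2.1
  have hnn : ∀ k, 0 ≤ w (u k).1.1 * s (u k).1.1 := fun k =>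
    mul_nonneg (hpos _ (hball k)).le (hs _ (hball k)).pos.le
  have hsum : ∀ n, ∑ k ∈ Finset.range n, w (u k).1.1 * s (u k).1.1 = 2 * (L - (u n).1.2) := by
    intro n
    induction n with
    | zero => simp [u]
    | succ n ih => rw [Finset.sum_range_succ, ih, hu, hval]; ring
  have hsummable : Summable fun k => w (u k).1.1 * s (u k).1.1 := by
    refine summable_of_sum_range_le (c := 2 * L) hnn fun n => ?_
    have : 0 ≤ (u n).1.2 := (u n).2.2 _ (IsConformalCutoff.zero hpos)
    rw [hsum]; linarith
  refine ⟨fun k => (u k).1.1, fun k => s (u k).1.1, fun k => hs _ (hball k), fun k => ?_,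
    hsummable, fun r hr => ?_⟩
  · simp only [hu]; exact hdist (u k)
  · obtain ⟨σ, hσ, hσs⟩ := hs' r hr
    have hsub : closedBall (0 : E) r ⊆ ball 0 1 := closedBall_subset_ball hr
    obtain ⟨m, hm, hmw⟩ : ∃ m > 0, ∀ x ∈ closedBall (0 : E) r, m ≤ w x := by
      rcases (closedBall (0 : E) r).eq_empty_or_nonempty with he | hne
      · exact ⟨1, one_pos, by simp [he]⟩
      · obtain ⟨a, ha, hmin⟩ := (isCompact_closedBall (0 : E) r).exists_isMinOn hne (hw.mono hsub)
        exact ⟨w a, hpos a (hsub ha), fun x hx => hmin hx⟩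
    filter_upwards [hsummable.tendsto_atTop_zero.eventually_lt_const (mul_pos hm hσ)] with k hk
    by_contra! hle
    exact absurd hk (not_lt.2 (mul_le_mul (hmw _ (mem_closedBall_zero_iff.2 hle)) (hσs _ hle) hσ.le
      (hpos _ (hball k)).le))

end ConformalMetric


section PolygonalCurve

variable {E : Type*} [NormedAddCommGroup E] [NormedSpace ℝ E]

theorem deriv_smoothTransition_eq_zero_of_one_le {t : ℝ} (ht : 1 ≤ t) :
    deriv Real.smoothTransition t = 0 := by
  refine IsLocalMax.deriv_eq_zero (Filter.Eventually.of_forall fun y => ?_)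
  rw [Real.smoothTransition.one_of_one_le ht]
  exact Real.smoothTransition.le_one y

/-- Any sequence of points is joined by a `C¹` curve on `[0, 1)` that runs through the segment
between consecutive points during the dyadic interval `[1 - 2⁻ᵏ, 1 - 2⁻⁽ᵏ⁺¹⁾)`. -/
theorem exists_contDiffOn_curve_through : ∃ C : ℝ, 0 ≤ C ∧ ∀ x : ℕ → E, ∃ γ : ℝ → E,
    ContDiffOn ℝ 1 γ (Ico 0 1) ∧
    ∀ k, ∀ t ∈ Ico (1 - (1 / 2 : ℝ) ^ k) (1 - (1 / 2) ^ (k + 1)),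
      γ t ∈ segment ℝ (x k) (x (k + 1)) ∧
      ‖derivWithin γ (Ico 0 1) t‖ ≤ C * 2 ^ (k + 1) * dist (x (k + 1)) (x k) := by
  have hθ : ContDiff ℝ 1 Real.smoothTransition := Real.smoothTransition.contDiff
  obtain ⟨C, hC⟩ := (isCompact_Icc (a := (0 : ℝ)) (b := 1)).exists_bound_of_continuousOn
    (hθ.continuous_deriv le_rfl).continuousOn
  refine ⟨C, (norm_nonneg _).trans (hC 0 (by simp)), fun x => ?_⟩
  let u : ℕ → ℝ → ℝ := fun k t => 2 - 2 ^ (k + 1) * (1 - t)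
  let G : ℕ → ℝ → E := fun N t =>
    x 0 + ∑ k ∈ Finset.range N, Real.smoothTransition (u k t) • (x (k + 1) - x k)
  let γ : ℝ → E := fun t => x 0 + ∑' k, Real.smoothTransition (u k t) • (x (k + 1) - x k)
  have half : ∀ n : ℕ, (2 : ℝ) ^ n * (1 / 2) ^ n = 1 := fun n => by
    rw [← mul_pow]; norm_num
  have hγG : ∀ N t, t < 1 - (1 / 2 : ℝ) ^ N → γ t = G N t := by
    intro N t ht
    simp only [γ, G]
    rw [tsum_eq_sum fun k hk => ?_]
    rw [Real.smoothTransition.zero_of_nonpos, zero_smul]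
    have hk' : N ≤ k := by simpa using hk
    have h1 : (2 : ℝ) ^ N ≤ 2 ^ k := pow_le_pow_right₀ (by norm_num) hk'
    have h3 : (0 : ℝ) < (1 / 2) ^ N := by positivity
    have h4 : (2 : ℝ) ^ N * (1 / 2) ^ N ≤ 2 ^ k * (1 - t) :=
      mul_le_mul h1 (by linarith) h3.le (by positivity)
    rw [half] at h4
    simp only [u, pow_succ]
    linarith
  have hev : ∀ N t, t < 1 - (1 / 2 : ℝ) ^ N → γ =ᶠ[nhds t] G N := fun N t ht => by
    filter_upwards [isOpen_Iio.mem_nhds ht] with z hz using hγG N z hz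
  have hG : ∀ N, ContDiff ℝ 1 (G N) := fun N =>
    contDiff_const.add (ContDiff.sum fun k _ => (hθ.comp (by fun_prop)).smul contDiff_const)
  have hG' : ∀ N t, HasDerivAt (G N) (∑ k ∈ Finset.range N,
      (deriv Real.smoothTransition (u k t) * 2 ^ (k + 1)) • (x (k + 1) - x k)) t := by
    intro N t
    refine (HasDerivAt.fun_sum fun k _ => ?_).const_add _
    have hu : HasDerivAt (u k) (2 ^ (k + 1)) t := by
      simpa using (((hasDerivAt_id t).const_sub 1).const_mul ((2 : ℝ) ^ (k + 1))).const_sub 2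
    exact ((hθ.differentiable one_ne_zero _).hasDerivAt.comp t hu).smul_const _
  refine ⟨γ, fun t ht => ?_, fun k t ht => ?_⟩
  · obtain ⟨n, hn, -⟩ := exists_nat_pow_near_of_lt_one (x := 1 - t) (y := (1 / 2 : ℝ))
      (by linarith [ht.2]) (by linarith [ht.1]) (by norm_num) (by norm_num)
    exact ((hG _).contDiffAt.congr_of_eventuallyEq
      (hev (n + 1) t (by linarith))).contDiffWithinAt
  · have h0 : ∀ n : ℕ, (0 : ℝ) < (1 / 2) ^ n := fun n => by positivity
    have hu1 : ∀ j < k, 1 ≤ u j t := by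
      intro j hj
      have h1 : (2 : ℝ) ^ (j + 1) ≤ 2 ^ k := pow_le_pow_right₀ (by norm_num) hj
      have h2 : (2 : ℝ) ^ (j + 1) * (1 - t) ≤ 2 ^ k * (1 / 2) ^ k :=
        mul_le_mul h1 (by linarith [ht.1]) (by linarith [ht.2, h0 (k + 1)]) (by positivity)
      rw [half] at h2
      simp only [u]; linarith
    have hu01 : u k t ∈ Icc (0 : ℝ) 1 := by
      have h2 : (2 : ℝ) ^ (k + 1) * (1 / 2) ^ (k + 1) ≤ 2 ^ (k + 1) * (1 - t) :=
        mul_le_mul_of_nonneg_left (by linarith [ht.2]) (by positivity)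
      have h3 : (2 : ℝ) ^ k * (1 - t) ≤ 2 ^ k * (1 / 2) ^ k :=
        mul_le_mul_of_nonneg_left (by linarith [ht.1]) (by positivity)
      rw [half] at h2 h3
      have h4 : (2 : ℝ) ^ (k + 1) = 2 * 2 ^ k := by ring
      simp only [u]
      constructor
      · rw [h4]; linarith
      · linarith
    constructor
    · rw [hγG (k + 1) t ht.2]
      have : ∑ j ∈ Finset.range k, Real.smoothTransition (u j t) • (x (j + 1) - x j)
          = x k - x 0 := by
        rw [← Finset.sum_range_sub]
        refine Finset.sum_congr rfl fun j hj => ?_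
        rw [Real.smoothTransition.one_of_one_le (hu1 j (Finset.mem_range.1 hj)), one_smul]
      rw [segment_eq_image']
      refine ⟨Real.smoothTransition (u k t), ⟨Real.smoothTransition.nonneg _,
        Real.smoothTransition.le_one _⟩, ?_⟩
      simp only [G]
      rw [Finset.sum_range_succ, this]
      abel
    · have htI : t ∈ Ico (0 : ℝ) 1 := by
        have : (1 / 2 : ℝ) ^ k ≤ 1 := pow_le_one₀ (by norm_num) (by norm_num)
        exact ⟨by linarith [ht.1], by linarith [ht.2, h0 (k + 1)]⟩
      have hd := ((hG' (k + 1) t).congr_of_eventuallyEq (hev (k + 1) t ht.2))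
      rw [hd.hasDerivWithinAt.derivWithin (uniqueDiffOn_Ico 0 1 t htI), Finset.sum_range_succ,
        Finset.sum_eq_zero fun j hj => by
          rw [deriv_smoothTransition_eq_zero_of_one_le (hu1 j (Finset.mem_range.1 hj)), zero_mul,
            zero_smul], zero_add, norm_smul, norm_mul, dist_eq_norm, norm_pow, Real.norm_two]
      gcongr
      exact hC _ hu01

end PolygonalCurve

section FiniteLength

variable {E : Type*} [NormedAddCommGroup E] [NormedSpace ℝ E]

/-- If all cutoffs are bounded at one point, some `C¹` curve leaving every compact subset of the
ball has finite length. -/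
theorem exists_finite_length_curve_of_cutoff_le [ProperSpace E] [Nontrivial E] {w : E → ℝ}
    (hw : ContinuousOn w (ball 0 1)) (hpos : ∀ x ∈ ball (0 : E) 1, 0 < w x) {x₀ : E} {L : ℝ}
    (hx₀ : x₀ ∈ ball (0 : E) 1) (hL : ∀ f, IsConformalCutoff w f → f x₀ ≤ L) :
    ∃ γ : ℝ → E, ContDiffOn ℝ 1 γ (Ico 0 1) ∧ (∀ t ∈ Ico (0 : ℝ) 1, γ t ∈ ball (0 : E) 1) ∧
      (∀ K : Set E, IsCompact K → K ⊆ ball 0 1 →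
        ∃ t₀ ∈ Ico (0 : ℝ) 1, ∀ t ∈ Ico (0 : ℝ) 1, t₀ ≤ t → γ t ∉ K) ∧
      ∫⁻ t in Ico (0 : ℝ) 1, ENNReal.ofReal (‖derivWithin γ (Ico 0 1) t‖ * w (γ t)) ≠ ⊤ := by
  obtain ⟨x, s, hs, hdist, hsum, hdiv⟩ := exists_seq_of_cutoff_le hw hpos hx₀ hL
  obtain ⟨C, hC, hcurve⟩ := exists_contDiffOn_curve_through (E := E)
  obtain ⟨γ, hγ, hγx⟩ := hcurve x
  have h0 : ∀ n : ℕ, (0 : ℝ) < (1 / 2) ^ n := fun n => by positivity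
  have hdyadic : ∀ t ∈ Ico (0 : ℝ) 1,
      ∃ k, t ∈ Ico (1 - (1 / 2 : ℝ) ^ k) (1 - (1 / 2) ^ (k + 1)) := by
    intro t ht
    obtain ⟨n, hn, hn'⟩ := exists_nat_pow_near_of_lt_one (x := 1 - t) (y := (1 / 2 : ℝ))
      (by linarith [ht.2]) (by linarith [ht.1]) (by norm_num) (by norm_num)
    exact ⟨n, by linarith, by linarith⟩
  have hmem : ∀ k, ∀ t ∈ Ico (1 - (1 / 2 : ℝ) ^ k) (1 - (1 / 2) ^ (k + 1)),
      γ t ∈ closedBall (x k) (s k) := by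
    intro k t ht
    refine (convex_closedBall (x k) (s k)).segment_subset (mem_closedBall_self (hs k).pos.le) ?_
      (hγx k t ht).1
    rw [mem_closedBall, hdist]
  refine ⟨γ, hγ, fun t ht => ?_, fun K hK hK1 => ?_, ?_⟩
  · obtain ⟨k, hk⟩ := hdyadic t ht
    exact (hs k).subset (hmem k t hk)
  · obtain ⟨r, hr, hKr⟩ : ∃ r < 1, ∀ z ∈ K, ‖z‖ ≤ r := by
      rcases K.eq_empty_or_nonempty with rfl | hne
      · exact ⟨0, one_pos, by simp⟩
      · obtain ⟨a, ha, hmax⟩ := hK.exists_isMaxOn hne continuous_norm.continuousOn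
        exact ⟨‖a‖, mem_ball_zero_iff.1 (hK1 ha), fun z hz => hmax hz⟩
    obtain ⟨N, hN⟩ := Filter.eventually_atTop.1 (hdiv ((1 + 2 * r) / 3) (by linarith))
    have hN1 : (1 / 2 : ℝ) ^ N ≤ 1 := pow_le_one₀ (by norm_num) (by norm_num)
    refine ⟨1 - (1 / 2) ^ N, ⟨by linarith, by linarith [h0 N]⟩, fun t ht hNt hγK => ?_⟩
    obtain ⟨k, hk⟩ := hdyadic t ht
    have hNk : N ≤ k := by
      by_contra! hlt
      have : (1 / 2 : ℝ) ^ N ≤ (1 / 2) ^ (k + 1) :=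
        pow_le_pow_of_le_one (by norm_num) (by norm_num) hlt
      linarith [hk.2]
    have h1 := hN k hNk
    have h2 := (hs k).norm_le (hmem k t hk)
    have h3 := hKr _ hγK
    linarith
  · have hpiece : ∀ k, ∫⁻ t in Ico (1 - (1 / 2 : ℝ) ^ k) (1 - (1 / 2) ^ (k + 1)),
        ENNReal.ofReal (‖derivWithin γ (Ico 0 1) t‖ * w (γ t)) ≤
        ENNReal.ofReal (2 * C * (w (x k) * s k)) := by
      intro k
      have hwk : 0 ≤ w (x k) := (hpos _ ((hs k).subset (mem_closedBall_self (hs k).pos.le))).le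
      calc _ ≤ ∫⁻ t in Ico (1 - (1 / 2 : ℝ) ^ k) (1 - (1 / 2) ^ (k + 1)),
            ENNReal.ofReal (C * 2 ^ (k + 1) * s k * (2 * w (x k))) := by
            refine MeasureTheory.setLIntegral_mono' measurableSet_Ico fun t ht => ?_
            refine ENNReal.ofReal_le_ofReal ?_
            have h1 := (hγx k t ht).2
            rw [hdist] at h1
            have h2 := (hs k).le_center _ (hmem k t ht)
            have h3 := (hpos _ ((hs k).subset (hmem k t ht))).le
            exact mul_le_mul h1 h2 h3 ((norm_nonneg _).trans h1)
        _ = ENNReal.ofReal (2 * C * (w (x k) * s k)) := by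
            have hsk := (hs k).pos.le
            rw [MeasureTheory.setLIntegral_const, Real.volume_Ico,
              ← ENNReal.ofReal_mul (by positivity)]
            congr 1
            have : (2 : ℝ) ^ k * (1 / 2) ^ k = 1 := by rw [← mul_pow]; norm_num
            calc _ = 2 * C * (w (x k) * s k) * ((2 : ℝ) ^ k * (1 / 2) ^ k) := by ring
              _ = _ := by rw [this, mul_one]
    refine ne_top_of_le_ne_top (hsum.mul_left (2 * C)).tsum_ofReal_ne_top ?_
    calc _ ≤ ∫⁻ t in ⋃ k : ℕ, Ico (1 - (1 / 2 : ℝ) ^ k) (1 - (1 / 2) ^ (k + 1)),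
          ENNReal.ofReal (‖derivWithin γ (Ico 0 1) t‖ * w (γ t)) :=
          MeasureTheory.lintegral_mono_set fun t ht => mem_iUnion.2 (hdyadic t ht)
      _ ≤ _ := MeasureTheory.lintegral_iUnion_le _ _
      _ ≤ _ := ENNReal.tsum_le_tsum hpiece

end FiniteLength

section Mollification

open MeasureTheory ContinuousLinearMap
open scoped Convolution

variable {E : Type*} [NormedAddCommGroup E] [InnerProductSpace ℝ E] [FiniteDimensional ℝ E]
  [MeasurableSpace E] [BorelSpace E]

theorem dist_normed_convolution_le_of_lipschitz_near {μ : Measure E} [μ.IsAddHaarMeasure]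
    (η : ContDiffBump (0 : E)) {f : E → ℝ} (hf : Continuous f) {y z : E} {B : ℝ}
    (h : ∀ t ∈ ball (0 : E) η.rOut, dist (f (y - t)) (f (z - t)) ≤ B) :
    dist ((η.normed μ ⋆[lsmul ℝ ℝ, μ] f : E → ℝ) y) ((η.normed μ ⋆[lsmul ℝ ℝ, μ] f : E → ℝ) z)
      ≤ B := by
  have hint : ∀ y, Integrable (fun t => η.normed μ t * f (y - t)) μ := fun y =>
    (η.continuous_normed.mul <| hf.comp <|
      continuous_const.sub continuous_id).integrable_of_hasCompactSupport
      η.hasCompactSupport_normed.mul_right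
  simp only [convolution_def, lsmul_apply, smul_eq_mul]
  rw [dist_eq_norm, ← integral_sub (hint y) (hint z)]
  calc _ ≤ ∫ t, η.normed μ t * B ∂μ := by
        refine norm_integral_le_of_norm_le (η.integrable_normed.mul_const B)
          (Filter.Eventually.of_forall fun t => ?_)
        rw [← mul_sub, norm_mul, Real.norm_of_nonneg (η.nonneg_normed t)]
        by_cases ht : t ∈ ball (0 : E) η.rOut
        · rw [← dist_eq_norm]
          exact mul_le_mul_of_nonneg_left (h t ht) (η.nonneg_normed t)
        · rw [← η.support_normed_eq (μ := μ), Function.notMem_support] at ht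
          simp [ht]
    _ = B := by rw [integral_mul_const, η.integral_normed, one_mul]

theorem IsConformalCutoff.exists_contDiff {w f : E → ℝ} (hw : ContinuousOn w (ball 0 1))
    (hpos : ∀ x ∈ ball (0 : E) 1, 0 < w x) (hf : IsConformalCutoff w f) :
    ∃ ψ : E → ℝ, ContDiff ℝ (⊤ : ℕ∞) ψ ∧ HasCompactSupport ψ ∧ tsupport ψ ⊆ ball 0 1 ∧
      (∀ x ∈ ball (0 : E) 1, ‖fderiv ℝ ψ x‖ ≤ 2 * w x) ∧ ∀ x, |ψ x - f x| ≤ 1 := by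
  have hfc := hf.continuous hw
  obtain ⟨r, hr, h0⟩ := hf.eq_zero
  obtain ⟨σ, hσ, hσx⟩ := exists_isHarnackRadius_of_norm_le hw hpos
    (show (1 + r) / 2 < 1 by linarith)
  have hfs : HasCompactSupport f := HasCompactSupport.intro (isCompact_closedBall (0 : E) r)
    fun z hz => h0 z (by rw [mem_closedBall_zero_iff, not_le] at hz; exact hz.le)
  obtain ⟨δ, hδ, hδf⟩ := Metric.uniformContinuous_iff.1
    (hfs.uniformContinuous_of_continuous hfc) 1 one_pos
  set ρ := min δ (min (σ / 2) ((1 - r) / 4)) with hρdef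
  have hρ : 0 < ρ := lt_min hδ (lt_min (by linarith) (by linarith))
  have hρ1 : ρ ≤ δ := min_le_left _ _
  have hρ2 : ρ ≤ σ / 2 := (min_le_right _ _).trans (min_le_left _ _)
  have hρ3 : ρ ≤ (1 - r) / 4 := (min_le_right _ _).trans (min_le_right _ _)
  let η : ContDiffBump (0 : E) := ⟨ρ / 2, ρ, by linarith, by linarith⟩
  have hηr : η.rOut = ρ := rfl
  set ψ : E → ℝ := (η.normed volume ⋆[lsmul ℝ ℝ, volume] f) with hψ
  have hψ0 : ∀ x, (1 + 3 * r) / 4 + (1 - r) / 4 ≤ ‖x‖ → ψ x = 0 := by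
    intro x hx
    have hz : ∀ z ∈ ball x η.rOut, f z = 0 := by
      intro z hz
      have h3 : ‖x‖ ≤ ‖z‖ + ‖x - z‖ := by simpa using norm_add_le z (x - z)
      rw [mem_ball', dist_eq_norm, hηr] at hz
      exact h0 z (by linarith)
    have hx0 := hz x (mem_ball_self η.rOut_pos)
    rw [hψ, η.normed_convolution_eq_right fun z hz' => (hz z hz').trans hx0.symm, hx0]
  have hψs : tsupport ψ ⊆ closedBall 0 ((1 + r) / 2) := by
    refine closure_minimal (fun x hx => ?_) isClosed_closedBall
    by_contra hcon
    rw [mem_closedBall_zero_iff, not_le] at hcon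
    exact hx (hψ0 x (by linarith))
  refine ⟨ψ, ?_, (isCompact_closedBall (0 : E) ((1 + r) / 2)).of_isClosed_subset
    (isClosed_tsupport _) hψs, hψs.trans (closedBall_subset_ball (by linarith)), ?_, ?_⟩
  · exact η.hasCompactSupport_normed.contDiff_convolution_left _ η.contDiff_normed
      hfc.locallyIntegrable
  · intro x hx
    have hwx := hpos x hx
    by_cases hxr : ‖x‖ ≤ (1 + r) / 2
    · have hH := hσx x hxr
      have hlip := hf.sub_le _ (convex_closedBall x σ) hH.subset _ hH.le_center
      refine norm_fderiv_le_of_lip' ℝ (by linarith) ?_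
      filter_upwards [ball_mem_nhds x (half_pos hσ)] with y hy
      rw [← dist_eq_norm, ← dist_eq_norm]
      refine dist_normed_convolution_le_of_lipschitz_near η hfc fun t ht => ?_
      rw [mem_ball_zero_iff, hηr] at ht
      have hy1 : y - t ∈ closedBall x σ := by
        rw [mem_closedBall, dist_eq_norm, sub_right_comm]
        rw [mem_ball, dist_eq_norm] at hy
        exact (norm_sub_le _ _).trans (by linarith)
      have hx1 : x - t ∈ closedBall x σ := by
        rw [mem_closedBall, dist_eq_norm, sub_sub_cancel_left, norm_neg]
        linarith
      have h1 := hlip _ hy1 _ hx1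
      have h2 := hlip _ hx1 _ hy1
      rw [dist_comm] at h2
      rw [dist_sub_right] at h1 h2
      rw [Real.dist_eq, abs_le]
      constructor <;> linarith
    · rw [fderiv_of_notMem_tsupport ℝ fun hmem => hxr (mem_closedBall_zero_iff.1 (hψs hmem)),
        norm_zero]
      linarith
  · intro x
    rw [← Real.dist_eq]
    refine η.dist_normed_convolution_le hfc.aestronglyMeasurable fun z hz => (hδf ?_).le
    exact (mem_ball.1 hz).trans_le hρ1

/-- If the cutoffs are unbounded at `x₀`, there are smooth ones that are large near `x₀`. -/
theorem exists_contDiff_cutoff_large {w : E → ℝ} (hw : ContinuousOn w (ball 0 1))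
    (hpos : ∀ x ∈ ball (0 : E) 1, 0 < w x) {x₀ : E} {s : ℝ} (hs : IsHarnackRadius w x₀ s)
    (hunb : ∀ L : ℝ, ∃ f, IsConformalCutoff w f ∧ L < f x₀) (L : ℝ) :
    ∃ ψ : E → ℝ, ContDiff ℝ (⊤ : ℕ∞) ψ ∧ HasCompactSupport ψ ∧ tsupport ψ ⊆ ball 0 1 ∧
      (∀ x ∈ ball (0 : E) 1, ‖fderiv ℝ ψ x‖ ≤ 2 * w x) ∧ ∀ x ∈ closedBall x₀ s, L ≤ ψ x := by
  obtain ⟨f, hf, hfL⟩ := hunb (L + 1 + 2 * w x₀ * s)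
  obtain ⟨ψ, h1, h2, h3, h4, h5⟩ := hf.exists_contDiff hw hpos
  refine ⟨ψ, h1, h2, h3, h4, fun x hx => ?_⟩
  have hx₀ := mem_closedBall_self (x := x₀) hs.pos.le
  have h6 := hf.sub_le _ (convex_closedBall x₀ s) hs.subset _ hs.le_center _ hx₀ _ hx
  have h7 : 2 * w x₀ * dist x₀ x ≤ 2 * w x₀ * s :=
    mul_le_mul_of_nonneg_left (mem_closedBall'.1 hx) (by linarith [hpos _ (hs.subset hx₀)])
  have h8 := abs_le.1 (h5 x)
  linarith [h8.1]

end Mollification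

section Stability

open MeasureTheory

theorem norm_gradient_sq {n : ℕ} (f : EuclideanSpace ℝ (Fin n) → ℝ)
    (x : EuclideanSpace ℝ (Fin n)) :
    ‖gradient f x‖ ^ 2 = ∑ i, fderiv ℝ f x (EuclideanSpace.single i 1) ^ 2 := by
  rw [EuclideanSpace.norm_sq_eq]
  refine Finset.sum_congr rfl fun i _ => ?_
  have h : inner ℝ (gradient f x) (EuclideanSpace.single i 1)
      = fderiv ℝ f x (EuclideanSpace.single i 1) := InnerProductSpace.toDual_symm_apply
  rw [EuclideanSpace.inner_single_right] at h
  rw [← h]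
  simp

theorem norm_gradient_eq_norm_fderiv {F : Type*} [NormedAddCommGroup F] [InnerProductSpace ℝ F]
    [CompleteSpace F] (f : F → ℝ) (x : F) : ‖gradient f x‖ = ‖fderiv ℝ f x‖ :=
  LinearIsometryEquiv.norm_map _ _

theorem integral_fderiv_apply_eq_zero {E : Type*} [NormedAddCommGroup E] [NormedSpace ℝ E]
    [FiniteDimensional ℝ E] [MeasurableSpace E] [BorelSpace E] (μ : Measure E) [μ.IsAddHaarMeasure]
    {F : E → ℝ} (hF : ContDiff ℝ 1 F) (hs : HasCompactSupport F) (e : E) :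
    ∫ x, fderiv ℝ F x e ∂μ = 0 := by
  have hd : Integrable (fun x => fderiv ℝ F x e) μ :=
    ((hF.continuous_fderiv one_ne_zero).clm_apply continuous_const).integrable_of_hasCompactSupport
      (hs.fderiv_apply ℝ e)
  simpa using integral_mul_fderiv_eq_neg_fderiv_mul_of_integrable (μ := μ)
    (f := fun _ : E => (1 : ℝ)) (g := F) (v := e) (by simp) (by simpa using hd)
    (by simpa using hF.continuous.integrable_of_hasCompactSupport hs) (by simp)
    (fun x _ => hF.differentiable one_ne_zero x)

variable {n : ℕ} {β : ℝ} {Ω : Set (EuclideanSpace ℝ (Fin n))}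
  {v φ : EuclideanSpace ℝ (Fin n) → ℝ}

/-- Pointwise form of the Caccioppoli inequality: up to a divergence, the stability integrand is
controlled by the gradient of the test function. -/
theorem stability_integrand_le (hβ : β ∈ Ioo (1 / 2 : ℝ) 1) (hΩ : IsOpen Ω)
    (hv : ContDiffOn ℝ (⊤ : ℕ∞) v Ω) (hφ : ContDiff ℝ (⊤ : ℕ∞) φ)
    {x : EuclideanSpace ℝ (Fin n)} (hx : x ∈ Ω) :
    ‖gradient (fun y => φ y * v y) x‖ ^ 2
        + β * (v x * eLaplacian v x - ‖gradient v x‖ ^ 2) * φ x ^ 2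
      ≤ (1 + 2 * (1 - β) ^ 2 / (2 * β - 1)) * (v x * ‖fderiv ℝ φ x‖) ^ 2
        - (2 * β - 1) / 2 * (φ x * ‖fderiv ℝ v x‖) ^ 2
        + β * ∑ i, fderiv ℝ (fun y => φ y ^ 2 * (v y * fderiv ℝ v y (EuclideanSpace.single i 1))) x
          (EuclideanSpace.single i 1) := by
  have hvx : ContDiffAt ℝ (⊤ : ℕ∞) v x := hv.contDiffAt (hΩ.mem_nhds hx)
  have hdv : HasFDerivAt v (fderiv ℝ v x) x := (hvx.differentiableAt (by simp)).hasFDerivAt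
  have hdφ : HasFDerivAt φ (fderiv ℝ φ x) x :=
    (hφ.contDiffAt.differentiableAt (by simp)).hasFDerivAt
  have hddv : ∀ i, HasFDerivAt (fun y => fderiv ℝ v y (EuclideanSpace.single i 1))
      (fderiv ℝ (fun y => fderiv ℝ v y (EuclideanSpace.single i 1)) x) x := fun i =>
    (((hvx.fderiv_right (m := 1) (by norm_cast)).clm_apply contDiffAt_const).differentiableAt
      one_ne_zero).hasFDerivAt
  have hprod : fderiv ℝ (fun y => φ y * v y) x = _ := (hdφ.mul hdv).fderiv
  have hflux : ∀ i, fderiv ℝ (fun y => φ y ^ 2 * (v y * fderiv ℝ v y (EuclideanSpace.single i 1))) x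
      = _ := fun i => ((hdφ.pow 2).mul (hdv.mul (hddv i))).fderiv
  rw [← norm_gradient_eq_norm_fderiv φ, ← norm_gradient_eq_norm_fderiv v, mul_pow, mul_pow,
    norm_gradient_sq, norm_gradient_sq, norm_gradient_sq, eLaplacian, hprod]
  simp only [hflux]
  simp only [Finset.mul_sum, Finset.sum_mul, ← Finset.sum_sub_distrib, ← Finset.sum_add_distrib]
  refine Finset.sum_le_sum fun i _ => ?_
  simp only [add_apply, smul_apply, smul_eq_mul]
  set p := fderiv ℝ φ x (EuclideanSpace.single i 1)
  set q := fderiv ℝ v x (EuclideanSpace.single i 1)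
  set d := fderiv ℝ (fun y => fderiv ℝ v y (EuclideanSpace.single i 1)) x
    (EuclideanSpace.single i 1)
  have hβ' : 0 < 2 * β - 1 := by linarith [hβ.1]
  have key : (2 - 2 * β) * ((v x * p) * (φ x * q)) ≤
      (2 * β - 1) / 2 * (φ x * q) ^ 2 + 2 * (1 - β) ^ 2 / (2 * β - 1) * (v x * p) ^ 2 := by
    have h : (2 * β - 1) / 2 * (φ x * q) ^ 2 + 2 * (1 - β) ^ 2 / (2 * β - 1) * (v x * p) ^ 2
        - (2 - 2 * β) * ((v x * p) * (φ x * q))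
        = ((2 * β - 1) * (φ x * q) - 2 * (1 - β) * (v x * p)) ^ 2 / (2 * (2 * β - 1)) := by
      field_simp
      ring
    have : 0 ≤ ((2 * β - 1) * (φ x * q) - 2 * (1 - β) * (v x * p)) ^ 2 / (2 * (2 * β - 1)) := by
      positivity
    linarith
  norm_num
  linear_combination key

/-- Caccioppoli inequality for a test function whose gradient is at most `2` in the conformal
metric `v⁻² |dx|²` and which is at least `L` on `B`. -/
theorem stability_integral_bound (hβ : β ∈ Ioo (1 / 2 : ℝ) 1) (hΩ : IsOpen Ω)
    (hΩfin : volume Ω ≠ ⊤)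
    (hv : ContDiffOn ℝ (⊤ : ℕ∞) v Ω) (hφ : ContDiff ℝ (⊤ : ℕ∞) φ) (hφs : HasCompactSupport φ)
    (hφΩ : tsupport φ ⊆ Ω) (hgrad : ∀ x ∈ Ω, |v x| * ‖fderiv ℝ φ x‖ ≤ 2)
    (hpos : 0 < ∫ x in Ω, (‖gradient (fun y => φ y * v y) x‖ ^ 2
      + β * (v x * eLaplacian v x - ‖gradient v x‖ ^ 2) * φ x ^ 2))
    {B : Set (EuclideanSpace ℝ (Fin n))} (hB : MeasurableSet B) (hBΩ : B ⊆ Ω) {L a : ℝ}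
    (hL : 0 ≤ L) (ha : 0 ≤ a) (hBL : ∀ x ∈ B, L ≤ φ x) (hBa : ∀ x ∈ B, a ≤ ‖fderiv ℝ v x‖) :
    (2 * β - 1) / 2 * (L * a) ^ 2 * volume.real B
      ≤ (1 + 2 * (1 - β) ^ 2 / (2 * β - 1)) * 4 * volume.real Ω := by
  have hβ' : 0 < 2 * β - 1 := by linarith [hβ.1]
  set C := 1 + 2 * (1 - β) ^ 2 / (2 * β - 1) with hC
  have hC0 : 0 ≤ C := by positivity
  set I := fun x => ‖gradient (fun y => φ y * v y) x‖ ^ 2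
      + β * (v x * eLaplacian v x - ‖gradient v x‖ ^ 2) * φ x ^ 2 with hI
  let F : Fin n → EuclideanSpace ℝ (Fin n) → ℝ := fun i y =>
    φ y ^ 2 * (v y * fderiv ℝ v y (EuclideanSpace.single i 1))
  have hIint : IntegrableOn I Ω := by
    by_contra hcon
    rw [integral_undef hcon] at hpos
    exact hpos.false
  have hFsupp : ∀ i, tsupport (F i) ⊆ tsupport φ := fun i =>
    closure_mono fun x hx hx0 => hx (by simp [F, hx0])
  have hFs : ∀ i, HasCompactSupport (F i) := fun i =>
    hφs.of_isClosed_subset (isClosed_tsupport _) (hFsupp i)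
  have hF : ∀ i, ContDiff ℝ 1 (F i) := by
    intro i
    rw [contDiff_iff_contDiffAt]
    intro x
    by_cases hx : x ∈ tsupport φ
    · have hvx : ContDiffAt ℝ (⊤ : ℕ∞) v x := hv.contDiffAt (hΩ.mem_nhds (hφΩ hx))
      exact ((hφ.contDiffAt.of_le (by norm_cast)).pow 2).mul
        ((hvx.of_le (by norm_cast)).mul
          ((hvx.fderiv_right (m := 1) (by norm_cast)).clm_apply contDiffAt_const))
    · exact contDiffAt_const.congr_of_eventuallyEq
        (notMem_tsupport_iff_eventuallyEq.1 fun h => hx (hFsupp i h))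
  have hdF : ∀ i, Integrable (fun x => fderiv ℝ (F i) x (EuclideanSpace.single i 1)) :=
    fun i => (((hF i).continuous_fderiv one_ne_zero).clm_apply
      continuous_const).integrable_of_hasCompactSupport ((hFs i).fderiv_apply ℝ _)
  have hdiv : ∫ x in Ω, ∑ i, fderiv ℝ (F i) x (EuclideanSpace.single i 1) = 0 := by
    rw [integral_finsetSum _ fun i _ => (hdF i).integrableOn]
    refine Finset.sum_eq_zero fun i _ => ?_
    rw [setIntegral_eq_integral_of_forall_compl_eq_zero fun x hx => by
      rw [fderiv_of_notMem_tsupport ℝ fun h => hx (hφΩ (hFsupp i h)),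
        zero_apply]]
    exact integral_fderiv_apply_eq_zero volume (hF i) (hFs i) _
  have hdivint : IntegrableOn (fun x => ∑ i, fderiv ℝ (F i) x (EuclideanSpace.single i 1)) Ω :=
    integrable_finsetSum _ fun i _ => (hdF i).integrableOn
  have hconst : IntegrableOn (fun _ : EuclideanSpace ℝ (Fin n) => C * 4) Ω :=
    integrableOn_const hΩfin
  have hpt : ∀ x ∈ Ω, (2 * β - 1) / 2 * (φ x * ‖fderiv ℝ v x‖) ^ 2 ≤
      C * 4 + β * ∑ i, fderiv ℝ (F i) x (EuclideanSpace.single i 1) - I x := by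
    intro x hx
    have h1 := stability_integrand_le hβ hΩ hv hφ hx
    have h2 : (v x * ‖fderiv ℝ φ x‖) ^ 2 ≤ 4 := by
      have h3 := hgrad x hx
      have h4 : 0 ≤ |v x| * ‖fderiv ℝ φ x‖ := by positivity
      have h5 : (v x * ‖fderiv ℝ φ x‖) ^ 2 = (|v x| * ‖fderiv ℝ φ x‖) ^ 2 := by
        rw [mul_pow, mul_pow, sq_abs]
      rw [h5]
      nlinarith
    have h3 := mul_le_mul_of_nonneg_left h2 hC0
    simp only [hI, F]
    linarith
  have hsum : IntegrableOn (fun x => C * 4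
      + β * ∑ i, fderiv ℝ (F i) x (EuclideanSpace.single i 1)) Ω :=
    hconst.add (hdivint.const_mul β)
  have hsum : IntegrableOn (fun x => C * 4
      + β * ∑ i, fderiv ℝ (F i) x (EuclideanSpace.single i 1)) Ω :=
    hconst.add (hdivint.const_mul β)
  have hsum : IntegrableOn (fun x => C * 4
      + β * ∑ i, fderiv ℝ (F i) x (EuclideanSpace.single i 1)) Ω :=
    hconst.add (hdivint.const_mul β)
  have hint : IntegrableOn (fun x => C * 4
      + β * ∑ i, fderiv ℝ (F i) x (EuclideanSpace.single i 1) - I x) Ω :=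
    hsum.sub hIint
  calc (2 * β - 1) / 2 * (L * a) ^ 2 * volume.real B
      = ∫ _ in B, (2 * β - 1) / 2 * (L * a) ^ 2 := by
        rw [setIntegral_const, smul_eq_mul, mul_comm]
    _ ≤ ∫ x in B, (C * 4 + β * ∑ i, fderiv ℝ (F i) x (EuclideanSpace.single i 1) - I x) := by
        refine setIntegral_mono_on
          (integrableOn_const (measure_ne_top_of_subset hBΩ hΩfin))
          (hint.mono_set hBΩ) hB fun x hx => le_trans ?_ (hpt x (hBΩ hx))
        have := mul_le_mul (hBL x hx) (hBa x hx) ha (hL.trans (hBL x hx))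
        gcongr
    _ ≤ ∫ x in Ω, (C * 4 + β * ∑ i, fderiv ℝ (F i) x (EuclideanSpace.single i 1) - I x) := by
        refine setIntegral_mono_set hint ?_ hBΩ.eventuallyLE
        filter_upwards [ae_restrict_mem hΩ.measurableSet] with x hx
        exact le_trans (by positivity) (hpt x hx)
    _ = C * 4 * volume.real Ω - ∫ x in Ω, I x := by
        rw [integral_sub hsum hIint,
          integral_add hconst (hdivint.const_mul β), integral_const_mul β, hdiv, setIntegral_const,
          smul_eq_mul, mul_zero, add_zero, mul_comm]
    _ ≤ C * 4 * volume.real Ω := by linarith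

end Stability

/-- on the open unit disk `D ⊆ ℝ²` there is no positive smooth `v`
such that (i) `∫_D (‖∇(φv)‖² + β (vΔv − ‖∇v‖²) φ²) > 0` for every nonzero smooth
`φ` compactly supported in `D`, and (ii) the conformal metric `v^{-2}(dx²+dy²)` is
complete, i.e. every C¹ curve leaving every compact subset of `D` has infinite
length `∫ ‖γ′‖/v(γ)`. -/
theorem stmt_6 (β : ℝ) (hβ : β ∈ Set.Ioo (1 / 2 : ℝ) 1) :
    ¬ ∃ v : EuclideanSpace ℝ (Fin 2) → ℝ,
      ContDiffOn ℝ (⊤ : ℕ∞) v (Metric.ball 0 1) ∧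
      (∀ x ∈ Metric.ball (0 : EuclideanSpace ℝ (Fin 2)) 1, 0 < v x) ∧
      (∀ φ : EuclideanSpace ℝ (Fin 2) → ℝ, ContDiff ℝ (⊤ : ℕ∞) φ → HasCompactSupport φ →
        tsupport φ ⊆ Metric.ball 0 1 → φ ≠ 0 →
        0 < ∫ x in Metric.ball (0 : EuclideanSpace ℝ (Fin 2)) 1,
          (‖gradient (fun y => φ y * v y) x‖ ^ 2
            + β * (v x * eLaplacian v x - ‖gradient v x‖ ^ 2) * φ x ^ 2)) ∧
      (∀ γ : ℝ → EuclideanSpace ℝ (Fin 2),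
        ContDiffOn ℝ 1 γ (Set.Ico 0 1) →
        (∀ t ∈ Set.Ico (0 : ℝ) 1, γ t ∈ Metric.ball (0 : EuclideanSpace ℝ (Fin 2)) 1) →
        (∀ K : Set (EuclideanSpace ℝ (Fin 2)), IsCompact K → K ⊆ Metric.ball 0 1 →
          ∃ t₀ ∈ Set.Ico (0 : ℝ) 1, ∀ t ∈ Set.Ico (0 : ℝ) 1, t₀ ≤ t → γ t ∉ K) →
        ∫⁻ t in Set.Ico (0 : ℝ) 1,
          ENNReal.ofReal (‖derivWithin γ (Set.Ico 0 1) t‖ / v (γ t)) = ⊤) := by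
  rintro ⟨v, hv, hvpos, hstab, hcomplete⟩
  set w : EuclideanSpace ℝ (Fin 2) → ℝ := fun x => (v x)⁻¹ with hwdef
  have hw : ContinuousOn w (ball 0 1) := hv.continuousOn.inv₀ fun x hx => (hvpos x hx).ne'
  have hwpos : ∀ x ∈ ball (0 : EuclideanSpace ℝ (Fin 2)) 1, 0 < w x :=
    fun x hx => inv_pos.2 (hvpos x hx)
  have hunb : ∀ x₀ ∈ ball (0 : EuclideanSpace ℝ (Fin 2)) 1, ∀ L : ℝ,
      ∃ f, IsConformalCutoff w f ∧ L < f x₀ := by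
    intro x₀ hx₀ L
    by_contra! hcon
    obtain ⟨γ, h1, h2, h3, h4⟩ := exists_finite_length_curve_of_cutoff_le hw hwpos hx₀ hcon
    simp only [hwdef, ← div_eq_mul_inv] at h4
    exact h4 (hcomplete γ h1 h2 h3)
  have hcritical : EqOn (fderiv ℝ v) 0 (ball 0 1) := by
    intro x₀ hx₀
    by_contra hne
    have hapos : 0 < ‖fderiv ℝ v x₀‖ := norm_pos_iff.2 hne
    set a := ‖fderiv ℝ v x₀‖ / 2 with hadef
    obtain ⟨s, hs⟩ : ∃ s, IsHarnackRadius w x₀ s := by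
      obtain ⟨s, -, hs⟩ := exists_isHarnackRadius_of_norm_le hw hwpos (mem_ball_zero_iff.1 hx₀)
      exact ⟨s, hs x₀ le_rfl⟩
    have hcont : ContinuousAt (fun x => ‖fderiv ℝ v x‖) x₀ :=
      ((hv.continuousOn_fderiv_of_isOpen isOpen_ball (by simp)).continuousAt
        (isOpen_ball.mem_nhds hx₀)).norm
    obtain ⟨ε, hε, hεa⟩ := Metric.eventually_nhds_iff_ball.1
      (hcont.eventually_const_lt (half_lt_self hapos))
    have hBs : ball x₀ (min s ε) ⊆ closedBall x₀ s :=
      (ball_subset_ball (min_le_left _ _)).trans ball_subset_closedBall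
    have hB : 0 < MeasureTheory.volume.real (ball x₀ (min s ε)) :=
      ENNReal.toReal_pos (Metric.measure_ball_pos _ _ (lt_min hs.pos hε)).ne'
        MeasureTheory.measure_ball_lt_top.ne
    have hβ' : 0 < 2 * β - 1 := by linarith [hβ.1]
    set c := (2 * β - 1) / 2 * a ^ 2 * MeasureTheory.volume.real (ball x₀ (min s ε)) with hc
    have hcpos : 0 < c := by positivity
    set R := (1 + 2 * (1 - β) ^ 2 / (2 * β - 1)) * 4 *
      MeasureTheory.volume.real (ball (0 : EuclideanSpace ℝ (Fin 2)) 1) with hR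
    have hR0 : 0 ≤ R := by positivity
    set L := R / c + 1 with hL
    have hL1 : 1 ≤ L := by
      have : 0 ≤ R / c := by positivity
      linarith
    obtain ⟨ψ, h1, h2, h3, h4, h5⟩ := exists_contDiff_cutoff_large hw hwpos hs (hunb x₀ hx₀) L
    have hψ : ψ ≠ 0 := by
      rintro rfl
      have := h5 x₀ (mem_closedBall_self hs.pos.le)
      simp only [Pi.zero_apply] at this
      linarith
    have hbound := stability_integral_bound hβ isOpen_ball
      MeasureTheory.measure_ball_lt_top.ne hv h1 h2 h3
      (fun x hx => by
        have hvx := hvpos x hx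
        rw [abs_of_pos hvx]
        calc v x * ‖fderiv ℝ ψ x‖ ≤ v x * (2 * w x) :=
              mul_le_mul_of_nonneg_left (h4 x hx) hvx.le
          _ = 2 := by simp only [hwdef]; field_simp)
      (hstab ψ h1 h2 h3 hψ) (measurableSet_ball (x := x₀) (ε := min s ε)) (hBs.trans hs.subset)
      (by linarith : 0 ≤ L) (by positivity : 0 ≤ a) (fun x hx => h5 x (hBs hx))
      (fun x hx => (hεa x (ball_subset_ball (min_le_right _ _) hx)).le)
    have hLc : L ^ 2 * c ≤ R := by
      refine le_trans (le_of_eq ?_) hbound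
      rw [hc]; ring
    have hLc' : L * c = R + c := by rw [hL]; field_simp
    nlinarith
  obtain ⟨b, hb⟩ := isOpen_ball.exists_is_const_of_fderiv_eq_zero
    (convex_ball (0 : EuclideanSpace ℝ (Fin 2)) 1).isPreconnected
    (hv.differentiableOn (by simp)) hcritical
  have h0 : (0 : EuclideanSpace ℝ (Fin 2)) ∈ ball (0 : EuclideanSpace ℝ (Fin 2)) 1 :=
    mem_ball_self one_pos
  obtain ⟨f, hf, hlt⟩ := hunb 0 h0 b⁻¹
  obtain ⟨r, hr, hr0⟩ := hf.eq_zero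
  obtain ⟨z, hz⟩ := (NormedSpace.sphere_nonempty (x := (0 : EuclideanSpace ℝ (Fin 2)))).2
    (le_max_right r 0)
  have hz1 : ‖z‖ = max r 0 := mem_sphere_zero_iff_norm.1 hz
  have hzb : z ∈ ball (0 : EuclideanSpace ℝ (Fin 2)) 1 := by
    rw [mem_ball_zero_iff, hz1]; exact max_lt hr one_pos
  have h := hf.sub_le _ (convex_ball 0 1) subset_rfl b⁻¹
    (fun y hy => (congrArg Inv.inv (hb y hy)).le) 0 h0 z hzb
  have hb0 : 0 < b⁻¹ := by rw [← hb 0 h0]; exact hwpos 0 h0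
  rw [hr0 z (hz1 ▸ le_max_left _ _), dist_zero_left] at h
  have : b⁻¹ * ‖z‖ ≤ b⁻¹ * 1 :=
    mul_le_mul_of_nonneg_left (mem_ball_zero_iff.1 hzb).le hb0.le
  linarith
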